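/- Let P_r and P_g be probability measures on ℝ^d with P_r(M) = 1 and P_g(P) = 1 for closed sets M and P, and suppose P_r(M ∩ P) = 0 and P_g(M ∩ P) = 0. Then there exist disjoint open sets U, V ⊆ ℝ^d with P_r(U) = 1 and P_g(V) = 1, and the discriminator D* = 1_U (the indicator of U) has accuracy 1, maximizes L(D) over all measurable D : ℝ^d → [0,1], and is locally constant (hence differentiable with zero gradient) at every point of U ∪ V, a set of full measure for both P_r and P_g. -/

import Mathlib

open MeasureTheory

/-- The GAN discriminator objective
`L(D) = E_{x∼P_r}[log D(x)] + E_{x∼P_g}[log(1−D(x))]`. -/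
noncomputable def ganObjective {d : ℕ}
    (Pr Pg : Measure (EuclideanSpace ℝ (Fin d)))
    (D : EuclideanSpace ℝ (Fin d) → ℝ) : ℝ :=
  (∫ x, Real.log (D x) ∂Pr) + ∫ x, Real.log (1 - D x) ∂Pg

/-- The parts of two closed sets lying outside each other have disjoint open neighbourhoods. -/
theorem IsClosed.separatedNhds_diff {X : Type*} [TopologicalSpace X] [CompletelyNormalSpace X]
    {s t : Set X} (hs : IsClosed s) (ht : IsClosed t) : SeparatedNhds (s \ t) (t \ s) := by
  refine separatedNhds_iff_disjoint.2 (CompletelyNormalSpace.completely_normal ?_ ?_)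
  · exact Set.disjoint_sdiff_right.mono_left (closure_minimal Set.sdiff_subset hs)
  · exact Set.disjoint_sdiff_left.mono_right (closure_minimal Set.sdiff_subset ht)

/-- An indicator is locally constant at every point of an open set and at every point of an open
set disjoint from it. -/
theorem Set.indicator_eventuallyEq_of_mem_union {X β : Type*} [TopologicalSpace X] [Zero β]
    {U V : Set X} (hU : IsOpen U) (hV : IsOpen V) (hUV : Disjoint U V) (c : β) {x : X}
    (hx : x ∈ U ∪ V) :
    ∀ᶠ y in nhds x, U.indicator (fun _ => c) y = U.indicator (fun _ => c) x := by
  rcases hx with hx | hx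
  · filter_upwards [hU.mem_nhds hx] with y hy
    rw [Set.indicator_of_mem hy, Set.indicator_of_mem hx]
  · filter_upwards [hV.mem_nhds hx] with y hy
    rw [Set.indicator_of_notMem (hUV.notMem_of_mem_right hy),
      Set.indicator_of_notMem (hUV.notMem_of_mem_right hx)]

theorem ganObjective_nonpos {d : ℕ} (Pr Pg : Measure (EuclideanSpace ℝ (Fin d)))
    {D : EuclideanSpace ℝ (Fin d) → ℝ} (hD : ∀ x, D x ∈ Set.Icc (0 : ℝ) 1) :
    ganObjective Pr Pg D ≤ 0 :=
  add_nonpos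
    (integral_nonpos fun x => Real.log_nonpos (hD x).1 (hD x).2)
    (integral_nonpos fun x => Real.log_nonpos (by linarith [(hD x).2]) (by linarith [(hD x).1]))

theorem ganObjective_eq_zero_of_ae {d : ℕ} {Pr Pg : Measure (EuclideanSpace ℝ (Fin d))}
    {D : EuclideanSpace ℝ (Fin d) → ℝ} (hr : ∀ᵐ x ∂Pr, D x = 1) (hg : ∀ᵐ x ∂Pg, D x = 0) :
    ganObjective Pr Pg D = 0 := by
  have h₁ : ∫ x, Real.log (D x) ∂Pr = 0 :=
    integral_eq_zero_of_ae (hr.mono fun x hx => by simp [hx])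
  have h₂ : ∫ x, Real.log (1 - D x) ∂Pg = 0 :=
    integral_eq_zero_of_ae (hg.mono fun x hx => by simp [hx])
  rw [ganObjective, h₁, h₂, add_zero]

/-- **Perfect discrimination for distributions on closed sets with null intersection.**
If `P_r(M) = 1`, `P_g(P) = 1` for closed sets `M, P` with `P_r(M ∩ P) = 0 = P_g(M ∩ P)`,
then there exist disjoint open sets `U, V` of full measure for `P_r` resp. `P_g` such that
the indicator discriminator `D* = 1_U` has accuracy 1, maximizes the objective `L`, and is
locally constant — hence has zero derivative — at every point of `U ∪ V`, a set of full
measure for both `P_r` and `P_g`. -/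
theorem perfect_discriminator_closed_null_intersection {d : ℕ}
    (Pr Pg : Measure (EuclideanSpace ℝ (Fin d)))
    [IsProbabilityMeasure Pr] [IsProbabilityMeasure Pg]
    (M P : Set (EuclideanSpace ℝ (Fin d)))
    (hMclosed : IsClosed M) (hPclosed : IsClosed P)
    (hrM : Pr M = 1) (hgP : Pg P = 1)
    (hrMP : Pr (M ∩ P) = 0) (hgMP : Pg (M ∩ P) = 0) :
    ∃ U V : Set (EuclideanSpace ℝ (Fin d)),
      IsOpen U ∧ IsOpen V ∧ Disjoint U V ∧ Pr U = 1 ∧ Pg V = 1 ∧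
      (Pr {x | U.indicator (fun _ => (1 : ℝ)) x = 1} = 1 ∧
        Pg {x | U.indicator (fun _ => (1 : ℝ)) x = 0} = 1) ∧
      (∀ D : EuclideanSpace ℝ (Fin d) → ℝ, Measurable D →
        (∀ x, D x ∈ Set.Icc (0 : ℝ) 1) →
        ganObjective Pr Pg D ≤ ganObjective Pr Pg (U.indicator fun _ => (1 : ℝ))) ∧
      (∀ x ∈ U ∪ V,
        (∀ᶠ y in nhds x, U.indicator (fun _ => (1 : ℝ)) y =
          U.indicator (fun _ => (1 : ℝ)) x) ∧
        fderiv ℝ (U.indicator fun _ => (1 : ℝ)) x = 0) ∧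
      Pr (U ∪ V) = 1 ∧ Pg (U ∪ V) = 1 := by
  obtain ⟨U, V, hU, hV, hMU, hPV, hUV⟩ := hMclosed.separatedNhds_diff hPclosed
  have full_of_subset {μ : Measure (EuclideanSpace ℝ (Fin d))} [IsProbabilityMeasure μ]
      {s t : Set (EuclideanSpace ℝ (Fin d))} (hs : μ s = 1) (hst : s ⊆ t) : μ t = 1 :=
    le_antisymm prob_le_one (hs ▸ measure_mono hst)
  have hrU : Pr U = 1 := full_of_subset
    (by rw [← Set.sdiff_self_inter, measure_sdiff_null hrMP, hrM]) hMU
  have hgV : Pg V = 1 := full_of_subset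
    (by rw [← Set.sdiff_self_inter, measure_sdiff_null (Set.inter_comm M P ▸ hgMP), hgP]) hPV
  have hr : ∀ᵐ x ∂Pr, U.indicator (fun _ => (1 : ℝ)) x = 1 :=
    Filter.Eventually.mono ((mem_ae_iff_prob_eq_one hU.measurableSet).2 hrU) fun x hx =>
      Set.indicator_of_mem hx _
  have hg : ∀ᵐ x ∂Pg, U.indicator (fun _ => (1 : ℝ)) x = 0 :=
    Filter.Eventually.mono ((mem_ae_iff_prob_eq_one hV.measurableSet).2 hgV) fun x hx =>
      Set.indicator_of_notMem (hUV.notMem_of_mem_right hx) _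
  refine ⟨U, V, hU, hV, hUV, hrU, hgV, ⟨?_, ?_⟩, fun D _ hD => ?_, fun x hx => ?_,
    full_of_subset hrU Set.subset_union_left, full_of_subset hgV Set.subset_union_right⟩
  · exact full_of_subset hrU fun x hx => Set.indicator_of_mem hx _
  · exact full_of_subset hgV fun x hx => Set.indicator_of_notMem (hUV.notMem_of_mem_right hx) _
  · exact (ganObjective_nonpos Pr Pg hD).trans_eq (ganObjective_eq_zero_of_ae hr hg).symm
  · have hloc := Set.indicator_eventuallyEq_of_mem_union hU hV hUV (1 : ℝ) hx
    exact ⟨hloc, (Filter.EventuallyEq.fderiv_eq hloc).trans (fderiv_const_apply _)⟩
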